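/- (Practical formulas for Theorem 1.) Let F be a totally symmetric quadrilinear form on ℝ³ with components F_{ijkl} = F(e_i,e_j,e_k,e_l). Let h₁₁, h₁₂ be real numbers satisfying h₁₁² − h₁₂² = (1/4)(F₁₁₁₁ + F₂₂₂₂ − 6F₁₁₂₂) and 2h₁₁h₁₂ = F₁₁₁₂ − F₁₂₂₂ (such real numbers exist, being the real and imaginary parts of a complex square root). Define ω_m = (1/4)F₁₁₁₁ + (1/2)F₁₁₂₂ + (1/4)F₂₂₂₂ + (1/3)F₃₃₃₃ − (1/15)(h₁₁² + h₁₂²), ω′₁₁ = (5/8)F₁₁₁₁ + (1/4)F₁₁₂₂ − (3/8)F₂₂₂₂ − (1/3)F₃₃₃₃ + (1/42)(h₁₁² + h₁₂²), ω′₂₂ = −(3/8)F₁₁₁₁ + (1/4)F₁₁₂₂ + (5/8)F₂₂₂₂ − (1/3)F₃₃₃₃ + (1/42)(h₁₁² + h₁₂²), ω₁₂ = F₁₂₂₂ + F₁₁₁₂. Let ω′ be the traceless symmetric matrix with entries ω′₁₁, ω′₂₂, ω′₃₃ = −(ω′₁₁ + ω′₂₂), ω′₁₂ = ω′₂₁ =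 ω₁₂, ω′₁₃ = ω′₂₃ = 0, and let h be the traceless symmetric matrix with h₁₁, h₂₂ = −h₁₁, h₁₂ = h₂₁ = h₁₂, all entries in the third row and column zero. Then for every n ∈ ℛ(e₃): F(n,n,n,n) = ω_m + nᵀω′n + (nᵀh n)² − (4/7)‖n‖² nᵀh²n + (2/35)tr(h²)‖n‖⁴. -/

import Mathlib

open Matrix

/-- The out-of-plane direction `ν = e₃`. -/
def nu3 : Fin 3 → ℝ := ![0, 0, 1]

/-- The representation `ω_m + nᵀω′n + (nᵀhn)² − (4/7)‖n‖²nᵀh²n + (2/35)tr(h²)‖n‖⁴`. -/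
noncomputable def crackDensity4 (ωm : ℝ) (ω' h : Matrix (Fin 3) (Fin 3) ℝ)
    (n : Fin 3 → ℝ) : ℝ :=
  ωm + n ⬝ᵥ ω'.mulVec n + (n ⬝ᵥ h.mulVec n) ^ 2
    - 4 / 7 * (∑ i, n i ^ 2) * (n ⬝ᵥ (h * h).mulVec n)
    + 2 / 35 * (h * h).trace * (∑ i, n i ^ 2) ^ 2

/-- Components of a quadrilinear form on ℝ³ in the canonical basis. -/
noncomputable def comp4 (F : MultilinearMap ℝ (fun _ : Fin 4 => (Fin 3 → ℝ)) ℝ)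
    (i j k l : Fin 3) : ℝ :=
  F ![Pi.single i 1, Pi.single j 1, Pi.single k 1, Pi.single l 1]

/-- Additivity and homogeneity in the first slot. -/
theorem MultilinearMap.map_vecCons_add_smul
    (F : MultilinearMap ℝ (fun _ : Fin 4 => (Fin 3 → ℝ)) ℝ) (x y : ℝ) (a b u v w : Fin 3 → ℝ) :
    F ![x • a + y • b, u, v, w] = x * F ![a, u, v, w] + y * F ![b, u, v, w] :=
  (F.cons_add ![u, v, w] (x • a) (y • b)).trans
    (congrArg₂ (· + ·) (F.cons_smul ![u, v, w] x a) (F.cons_smul ![u, v, w] y b))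

/-- Binomial expansion of a totally symmetric quadrilinear form on the diagonal. -/
theorem symm_quadrilinear_diag_expand
    (F : MultilinearMap ℝ (fun _ : Fin 4 => (Fin 3 → ℝ)) ℝ)
    (hF : ∀ (σ : Equiv.Perm (Fin 4)) (v : Fin 4 → (Fin 3 → ℝ)), F (v ∘ σ) = F v)
    (x y : ℝ) (a b : Fin 3 → ℝ) :
    F (fun _ => x • a + y • b) =
      x ^ 4 * F ![a, a, a, a] + 4 * x ^ 3 * y * F ![a, a, a, b]
        + 6 * x ^ 2 * y ^ 2 * F ![a, a, b, b] + 4 * x * y ^ 3 * F ![a, b, b, b]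
        + y ^ 4 * F ![b, b, b, b] := by
  have swap01 (p q r s : Fin 3 → ℝ) : F ![p, q, r, s] = F ![q, p, r, s] := by
    rw [← hF (Equiv.swap 0 1) ![q, p, r, s]]
    congr 1; ext i; fin_cases i <;> rfl
  have swap12 (p q r s : Fin 3 → ℝ) : F ![p, q, r, s] = F ![p, r, q, s] := by
    rw [← hF (Equiv.swap 1 2) ![p, r, q, s]]
    congr 1; ext i; fin_cases i <;> rfl
  have swap23 (p q r s : Fin 3 → ℝ) : F ![p, q, r, s] = F ![p, q, s, r] := by
    rw [← hF (Equiv.swap 2 3) ![p, q, s, r]]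
    congr 1; ext i; fin_cases i <;> rfl
  have lin0 := F.map_vecCons_add_smul x y a b
  have lin1 (p r s : Fin 3 → ℝ) :
      F ![p, x • a + y • b, r, s] = x * F ![p, a, r, s] + y * F ![p, b, r, s] := by
    rw [swap01, lin0, swap01 a, swap01 b]
  have lin2 (p q s : Fin 3 → ℝ) :
      F ![p, q, x • a + y • b, s] = x * F ![p, q, a, s] + y * F ![p, q, b, s] := by
    rw [swap12, lin1, swap12 p a, swap12 p b]
  have lin3 (p q r : Fin 3 → ℝ) :
      F ![p, q, r, x • a + y • b] = x * F ![p, q, r, a] + y * F ![p, q, r, b] := by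
    rw [swap23, lin2, swap23 p q a, swap23 p q b]
  have hdiag : (fun _ : Fin 4 => x • a + y • b) =
      ![x • a + y • b, x • a + y • b, x • a + y • b, x • a + y • b] := by
    ext i; fin_cases i <;> rfl
  rw [hdiag]
  simp only [lin0, lin1, lin2, lin3]
  simp only [swap01 b a, swap12 _ b a, swap23 _ _ b a]
  ring

/-- **Practical formulas for Theorem 1.** Given a totally symmetric quadrilinear form `F`
on ℝ³ and reals `h₁₁, h₁₂` with `h₁₁² − h₁₂² = (1/4)(F₁₁₁₁ + F₂₂₂₂ − 6F₁₁₂₂)` and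
`2h₁₁h₁₂ = F₁₁₁₂ − F₁₂₂₂`, the explicit triple `(ω_m, ω′, h)` below represents `F` over the
mechanically accessible directions `ℛ(e₃)`. -/
theorem theorem1_practical_formulas
    (F : MultilinearMap ℝ (fun _ : Fin 4 => (Fin 3 → ℝ)) ℝ)
    (hF : ∀ (σ : Equiv.Perm (Fin 4)) (v : Fin 4 → (Fin 3 → ℝ)), F (v ∘ σ) = F v)
    (h11 h12 : ℝ)
    (hsq1 : h11 ^ 2 - h12 ^ 2 =
      1 / 4 * (comp4 F 0 0 0 0 + comp4 F 1 1 1 1 - 6 * comp4 F 0 0 1 1))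
    (hsq2 : 2 * h11 * h12 = comp4 F 0 0 0 1 - comp4 F 0 1 1 1)
    (ωm ω'11 ω'22 ω12 : ℝ)
    (hωm : ωm = 1 / 4 * comp4 F 0 0 0 0 + 1 / 2 * comp4 F 0 0 1 1 + 1 / 4 * comp4 F 1 1 1 1
      + 1 / 3 * comp4 F 2 2 2 2 - 1 / 15 * (h11 ^ 2 + h12 ^ 2))
    (hω11 : ω'11 = 5 / 8 * comp4 F 0 0 0 0 + 1 / 4 * comp4 F 0 0 1 1
      - 3 / 8 * comp4 F 1 1 1 1 - 1 / 3 * comp4 F 2 2 2 2 + 1 / 42 * (h11 ^ 2 + h12 ^ 2))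
    (hω22 : ω'22 = -(3 / 8) * comp4 F 0 0 0 0 + 1 / 4 * comp4 F 0 0 1 1
      + 5 / 8 * comp4 F 1 1 1 1 - 1 / 3 * comp4 F 2 2 2 2 + 1 / 42 * (h11 ^ 2 + h12 ^ 2))
    (hω12 : ω12 = comp4 F 0 1 1 1 + comp4 F 0 0 0 1)
    (ω' h : Matrix (Fin 3) (Fin 3) ℝ)
    (hω' : ω' = !![ω'11, ω12, 0; ω12, ω'22, 0; 0, 0, -(ω'11 + ω'22)])
    (hh : h = !![h11, h12, 0; h12, -h11, 0; 0, 0, 0]) :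
    ∀ n : Fin 3 → ℝ, ((∑ i, n i ^ 2 = 1 ∧ n ⬝ᵥ nu3 = 0) ∨ n = nu3) →
      F (fun _ => n) = crackDensity4 ωm ω' h n := by
  rintro n (⟨hn, hperp⟩ | rfl)
  · have hz : n 2 = 0 := by simpa [nu3, dotProduct, Fin.sum_univ_three] using hperp
    have hxy : n 0 ^ 2 + n 1 ^ 2 = 1 := by simpa [Fin.sum_univ_three, hz] using hn
    have hdecomp : n = n 0 • Pi.single 0 1 + n 1 • Pi.single 1 1 := by
      ext i; fin_cases i <;> simp [hz]
    have hexp := symm_quadrilinear_diag_expand F hF (n 0) (n 1) (Pi.single 0 1) (Pi.single 1 1)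
    rw [← hdecomp] at hexp
    simp only [← comp4.eq_1] at hexp
    rw [hexp, crackDensity4, hn, hω', hh]
    simp [Matrix.trace_fin_three, Matrix.mulVec, dotProduct,
      Fin.sum_univ_three, hz]
    linear_combination
      (ωm * (n 0 ^ 2 + n 1 ^ 2 + 1)
        + (n 0 ^ 2 * ω'11 + n 1 ^ 2 * ω'22 + 2 * n 0 * n 1 * ω12)
        - 4 / 7 * (h11 ^ 2 + h12 ^ 2) * (n 0 ^ 2 + n 1 ^ 2)
        + 4 / 35 * (h11 ^ 2 + h12 ^ 2) * (n 0 ^ 2 + n 1 ^ 2 + 1)) * hxy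
      - (n 0 ^ 2 + n 1 ^ 2) ^ 2 * hωm
      - (n 0 ^ 2 + n 1 ^ 2) * (n 0 ^ 2 * hω11 + n 1 ^ 2 * hω22 + 2 * n 0 * n 1 * hω12)
      - ((n 0 ^ 2 - n 1 ^ 2) ^ 2 - (2 * n 0 * n 1) ^ 2) / 2 * hsq1
      - (n 0 ^ 2 - n 1 ^ 2) * (2 * n 0 * n 1) * hsq2
  · have hF3 : F (fun _ => nu3) = comp4 F 2 2 2 2 := by
      rw [comp4]
      congr 1; ext i j; fin_cases i <;> fin_cases j <;> simp [nu3]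
    rw [hF3, crackDensity4, hω', hh]
    simp [Matrix.trace_fin_three, Matrix.mulVec, dotProduct, Fin.sum_univ_three, nu3]
    rw [hωm, hω11, hω22]
    ring
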